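/- Let G be a skeletal claw-free graph admitting an antihat 2-join ((X1,Y1),(X2,Y2)), and let l be an integer with l ≥ γ_ℓ^j(H2). If G1 = G[V1] has a proper l-colouring, then G has a proper l-colouring. -/

import Mathlib

open SimpleGraph

namespace Paper

variable {V : Type*} {W : Type*}

/-- A graph is claw-free if no vertex has three pairwise nonadjacent neighbours. -/
def ClawFree (G : SimpleGraph V) : Prop :=
  ¬ ∃ (v a b c : V), G.Adj v a ∧ G.Adj v b ∧ G.Adj v c ∧
      ¬G.Adj a b ∧ ¬G.Adj a c ∧ ¬G.Adj b c ∧ a ≠ b ∧ a ≠ c ∧ b ≠ c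

/-- A graph is quasi-line if every neighbourhood is covered by two cliques. -/
def QuasiLine (G : SimpleGraph V) : Prop :=
  ∀ v : V, ∃ S T : Set V, G.IsClique S ∧ G.IsClique T ∧ G.neighborSet v ⊆ S ∪ T

/-- The clique number ω(G). -/
noncomputable def cliqueNum (G : SimpleGraph V) : ℕ :=
  sSup {n | ∃ s : Finset V, G.IsNClique n s}

/-- The clique number of the subgraph induced on a vertex set `S`. -/
noncomputable def cliqueNumOn (G : SimpleGraph V) (S : Set V) : ℕ :=
  sSup {n | ∃ s : Finset V, ↑s ⊆ S ∧ G.IsNClique n s}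

/-- ω(v): the maximum size of a clique containing `v`. -/
noncomputable def omegaAt (G : SimpleGraph V) (v : V) : ℕ :=
  sSup {n | ∃ s : Finset V, G.IsNClique n s ∧ v ∈ s}

/-- The degree of a vertex (as the cardinality of its neighbourhood). -/
noncomputable def degree' (G : SimpleGraph V) (v : V) : ℕ := (G.neighborSet v).ncard

/-- The maximum degree Δ(G). -/
noncomputable def maxDeg (G : SimpleGraph V) : ℕ := sSup {n | ∃ v : V, n = degree' G v}

/-- γ_ℓ(v) = ⌈(d(v)+1+ω(v))/2⌉. -/
noncomputable def gammaLocalAt (G : SimpleGraph V) (v : V) : ℕ :=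
  (degree' G v + 1 + omegaAt G v + 1) / 2

/-- γ_ℓ(G) = max over vertices of γ_ℓ(v). -/
noncomputable def gammaLocal (G : SimpleGraph V) : ℕ :=
  sSup {n | ∃ v : V, n = gammaLocalAt G v}

/-- The closed neighbourhood of a vertex. -/
def closedNbhd (G : SimpleGraph V) (v : V) : Set V := insert v (G.neighborSet v)

/-- The closed neighbourhood within an induced subgraph on `S`. -/
def closedNbhdOn (G : SimpleGraph V) (S : Set V) (v : V) : Set V := S ∩ closedNbhd G v

/-- A triad: three pairwise nonadjacent vertices. -/
def IsTriad (G : SimpleGraph V) (T : Finset V) : Prop :=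
  T.card = 3 ∧ ∀ u ∈ T, ∀ w ∈ T, u ≠ w → ¬G.Adj u w

/-- A good triad within the induced subgraph on `S`: every vertex of the induced subgraph
outside `T` has two neighbours in `T`, or a twin in `T`, or is trumped by a vertex of `T`. -/
def GoodTriadOn (G : SimpleGraph V) (S : Set V) (T : Finset V) : Prop :=
  ↑T ⊆ S ∧ IsTriad G T ∧
    ∀ v ∈ S, v ∉ T →
      (∃ t1 ∈ T, ∃ t2 ∈ T, t1 ≠ t2 ∧ G.Adj v t1 ∧ G.Adj v t2) ∨
      (∃ t ∈ T, closedNbhdOn G S v = closedNbhdOn G S t) ∨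
      (∃ t ∈ T, closedNbhdOn G S v ⊂ closedNbhdOn G S t)

/-- A good triad in `G`. -/
def GoodTriad (G : SimpleGraph V) (T : Finset V) : Prop := GoodTriadOn G Set.univ T

/-- A homogeneous pair of cliques within the induced subgraph on `S`. -/
def IsHomPairOn (G : SimpleGraph V) (S : Set V) (A B : Finset V) : Prop :=
  ↑A ⊆ S ∧ ↑B ⊆ S ∧ G.IsClique (↑A : Set V) ∧ G.IsClique (↑B : Set V) ∧
    A.Nonempty ∧ B.Nonempty ∧ Disjoint A B ∧ 3 ≤ A.card + B.card ∧
    ∀ v ∈ S, v ∉ A → v ∉ B →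
      ((∀ a ∈ A, G.Adj v a) ∨ (∀ a ∈ A, ¬G.Adj v a)) ∧
      ((∀ b ∈ B, G.Adj v b) ∨ (∀ b ∈ B, ¬G.Adj v b))

/-- A homogeneous pair of cliques in `G`. -/
def IsHomPair (G : SimpleGraph V) (A B : Finset V) : Prop := IsHomPairOn G Set.univ A B

/-- A homogeneous pair of cliques `(A,B)` is skeletal if deleting any single edge
between `A` and `B` strictly decreases the clique number of `G[A ∪ B]`. -/
def IsSkeletalPair (G : SimpleGraph V) (A B : Finset V) : Prop :=
  ∀ a ∈ A, ∀ b ∈ B, G.Adj a b →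
    cliqueNumOn (G.deleteEdges {s(a, b)}) (↑A ∪ ↑B) < cliqueNumOn G (↑A ∪ ↑B)

/-- A graph is skeletal if every homogeneous pair of cliques in it is skeletal. -/
def Skeletal (G : SimpleGraph V) : Prop :=
  ∀ A B : Finset V, IsHomPair G A B → IsSkeletalPair G A B

/-- A linear pair: no induced C₄ between `A` and `B`. -/
def IsLinearPair (G : SimpleGraph V) (A B : Finset V) : Prop :=
  ¬ ∃ a1 ∈ A, ∃ a2 ∈ A, ∃ b1 ∈ B, ∃ b2 ∈ B,
      G.Adj a1 b1 ∧ G.Adj a2 b2 ∧ ¬G.Adj a1 b2 ∧ ¬G.Adj a2 b1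

/-- A homogeneous clique. -/
def IsHomogeneousClique [Fintype V] (G : SimpleGraph V) (C : Finset V) : Prop :=
  G.IsClique (↑C : Set V) ∧ 2 ≤ C.card ∧ C.card ≤ Fintype.card V - 1 ∧
    ∀ v ∉ C, (∀ c ∈ C, G.Adj v c) ∨ (∀ c ∈ C, ¬G.Adj v c)

/-- `X` straddles the three-cliquing `(A,B,C)` if it meets more than one of `A`, `B`, `C`. -/
def Straddles (A B C : Set V) (X : Finset V) : Prop :=
  ((↑X ∩ A).Nonempty ∧ (↑X ∩ B).Nonempty) ∨
  ((↑X ∩ A).Nonempty ∧ (↑X ∩ C).Nonempty) ∨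
  ((↑X ∩ B).Nonempty ∧ (↑X ∩ C).Nonempty)

/-- A three-cliqued graph is weakly skeletal if every nonskeletal homogeneous pair
of cliques is straddling. -/
def WeaklySkeletal (G : SimpleGraph V) (A B C : Set V) : Prop :=
  ∀ X Y : Finset V, IsHomPair G X Y → ¬IsSkeletalPair G X Y →
    Straddles A B C X ∨ Straddles A B C Y

/-- A set of unordered pairs forming a matching (pairwise disjoint non-loop pairs). -/
def IsMatchingSet (M : Set (Sym2 W)) : Prop :=
  (∀ e ∈ M, ¬e.IsDiag) ∧ ∀ e ∈ M, ∀ e' ∈ M, e ≠ e' → ∀ w : W, w ∈ e → w ∉ e'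

/-- `G[D]` is a thickening of `H[R]` under the matching `M`, via the fiber map `f`. -/
structure IsThickeningBetween (H : SimpleGraph W) (M : Set (Sym2 W)) (R : Set W)
    (G : SimpleGraph V) (D : Set V) (f : V → W) : Prop where
  maps_into : ∀ v ∈ D, f v ∈ R
  fibers_nonempty : ∀ w ∈ R, ∃ v ∈ D, f v = w
  fibers_clique : ∀ w : W, G.IsClique {v | v ∈ D ∧ f v = w}
  adj_of_adj : ∀ u ∈ D, ∀ v ∈ D, f u ≠ f v → H.Adj (f u) (f v) → s(f u, f v) ∉ M → G.Adj u v
  nonadj_of_nonadj : ∀ u ∈ D, ∀ v ∈ D, f u ≠ f v → ¬H.Adj (f u) (f v) → ¬G.Adj u v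
  semi_adj : ∀ x ∈ R, ∀ y ∈ R, s(x, y) ∈ M →
    ∃ u ∈ D, ∃ v ∈ D, f u = x ∧ f v = y ∧ G.Adj u v
  semi_nonadj : ∀ x ∈ R, ∀ y ∈ R, s(x, y) ∈ M →
    ∃ u ∈ D, ∃ v ∈ D, f u = x ∧ f v = y ∧ ¬G.Adj u v

/-- `G` is a thickening of `H[R]` under `M`. -/
def IsThickeningOn (H : SimpleGraph W) (M : Set (Sym2 W)) (R : Set W)
    (G : SimpleGraph V) (f : V → W) : Prop :=
  IsThickeningBetween H M R G Set.univ f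

/-- `G` is a thickening of `H` under `M`. -/
def IsThickening (H : SimpleGraph W) (M : Set (Sym2 W)) (G : SimpleGraph V) (f : V → W) : Prop :=
  IsThickeningBetween H M Set.univ G Set.univ f

/-- A graph is antiprismatic if every vertex outside a triad has exactly two
neighbours in it. -/
def Antiprismatic (H : SimpleGraph W) : Prop :=
  ∀ T : Finset W, IsTriad H T → ∀ v ∉ T,
    ∃ t ∈ T, ¬H.Adj v t ∧ ∀ t' ∈ T, t' ≠ t → H.Adj v t'

/-- A changeable matching in an antiprismatic graph. -/
def ChangeableMatching (H : SimpleGraph W) (M : Set (Sym2 W)) : Prop :=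
  M ⊆ H.edgeSet ∧ IsMatchingSet M ∧ ∀ M' ⊆ M, Antiprismatic (H.deleteEdges M')



/-- The icosahedron `G0` on vertices `v0, …, v11`. -/
def icoG0 : SimpleGraph (Fin 12) :=
  SimpleGraph.fromRel (fun i j =>
    (1 ≤ i.val ∧ i.val ≤ 10 ∧ (j.val = i.val % 10 + 1 ∨ j.val = (i.val + 1) % 10 + 1)) ∨
    (i.val = 0 ∧ j.val % 2 = 1 ∧ 1 ≤ j.val ∧ j.val ≤ 10) ∨
    (i.val = 11 ∧ j.val % 2 = 0 ∧ 1 ≤ j.val ∧ j.val ≤ 10))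

/-- `G1 = G0 − v11`. -/
def icoG1 : SimpleGraph (Fin 11) :=
  SimpleGraph.fromRel (fun i j =>
    (1 ≤ i.val ∧ (j.val = i.val % 10 + 1 ∨ j.val = (i.val + 1) % 10 + 1)) ∨
    (i.val = 0 ∧ j.val % 2 = 1))

/-- `G2 = G1 − v10`. -/
def icoG2 : SimpleGraph (Fin 10) :=
  SimpleGraph.fromRel (fun i j =>
    (1 ≤ i.val ∧ (j.val = i.val % 10 + 1 ∨ j.val = (i.val + 1) % 10 + 1)) ∨
    (i.val = 0 ∧ j.val % 2 = 1))

/-- An icosahedral thickening: a proper thickening of `G0` or `G1`, or a thickening of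
`G2 ∪ M` under a matching `M ⊆ {v1v4, v6v9}`. -/
def IsIcosahedralThickening (G : SimpleGraph V) : Prop :=
  (∃ f : V → Fin 12, IsThickening icoG0 ∅ G f) ∨
  (∃ f : V → Fin 11, IsThickening icoG1 ∅ G f) ∨
  (∃ (M : Set (Sym2 (Fin 10))) (f : V → Fin 10),
      M ⊆ {s((1 : Fin 10), 4), s(6, 9)} ∧
      IsThickening (icoG2 ⊔ SimpleGraph.fromEdgeSet M) M G f)

/-! ### Antihat graphs -/

/-- The vertex type of the antihat base graph: `A = {a0,…,ak}`, `B = {b0,…,bk}`,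
`C = {c1,…,ck}` (the third component `i` encodes `c_{i+1}`). -/
abbrev AHV (k : ℕ) : Type := Fin (k + 1) ⊕ Fin (k + 1) ⊕ Fin k

def ahA {k : ℕ} (i : Fin (k + 1)) : AHV k := Sum.inl i
def ahB {k : ℕ} (i : Fin (k + 1)) : AHV k := Sum.inr (Sum.inl i)
def ahC {k : ℕ} (i : Fin k) : AHV k := Sum.inr (Sum.inr i)

/-- The antihat base graph `H`, where `e00` records whether `a0` and `b0` are adjacent. -/
def antihatH (k : ℕ) (e00 : Bool) : SimpleGraph (AHV k) :=
  SimpleGraph.fromRel (fun x y =>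
    match x, y with
    | Sum.inl _, Sum.inl _ => True
    | Sum.inr (Sum.inl _), Sum.inr (Sum.inl _) => True
    | Sum.inr (Sum.inr _), Sum.inr (Sum.inr _) => True
    | Sum.inl i, Sum.inr (Sum.inl j) =>
        (i = j ∧ 1 ≤ i.val) ∨ (i.val = 0 ∧ j.val = 0 ∧ e00 = true)
    | Sum.inl i, Sum.inr (Sum.inr j) => 1 ≤ i.val ∧ i.val ≠ j.val + 1
    | Sum.inr (Sum.inl i), Sum.inr (Sum.inr j) => 1 ≤ i.val ∧ i.val ≠ j.val + 1
    | _, _ => False)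

/-- The conditions on the matching `M` of an antihat thickening with deleted set `Xd`. -/
def AntihatM (k : ℕ) (e00 : Bool) (Xd : Finset (AHV k)) (M : Set (Sym2 (AHV k))) : Prop :=
  IsMatchingSet M ∧
  (∀ e ∈ M, ∀ w : AHV k, w ∈ e → w ∉ Xd) ∧
  (∀ i j : Fin (k + 1), s(ahA i, ahA j) ∉ M) ∧
  (∀ i j : Fin (k + 1), s(ahB i, ahB j) ∉ M) ∧
  (∀ i j : Fin k, s(ahC i, ahC j) ∉ M) ∧
  (e00 = true → s(ahA (0 : Fin (k + 1)), ahB (0 : Fin (k + 1))) ∈ M) ∧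
  (∀ i j : Fin (k + 1), 1 ≤ i.val → 1 ≤ j.val → s(ahA i, ahB j) ∈ M →
      i = j ∧ ∃ c : Fin k, c.val + 1 = i.val ∧ ahC c ∈ Xd) ∧
  (∀ i : Fin (k + 1), ∀ j : Fin k, 1 ≤ i.val → s(ahB i, ahC j) ∈ M →
      i.val = j.val + 1 ∧ ahA i ∈ Xd) ∧
  (∀ i : Fin (k + 1), ∀ j : Fin k, 1 ≤ i.val → s(ahA i, ahC j) ∈ M →
      i.val = j.val + 1 ∧ ahB i ∈ Xd)

/-! ### Strips and generalized 2-joins -/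

/-- The induced subgraph on `S` contains an induced `W5` (a 5-wheel). -/
def HasInducedW5On (G : SimpleGraph V) (S : Set V) : Prop :=
  ∃ w c0 c1 c2 c3 c4 : V,
    w ∈ S ∧ c0 ∈ S ∧ c1 ∈ S ∧ c2 ∈ S ∧ c3 ∈ S ∧ c4 ∈ S ∧
    G.Adj w c0 ∧ G.Adj w c1 ∧ G.Adj w c2 ∧ G.Adj w c3 ∧ G.Adj w c4 ∧
    G.Adj c0 c1 ∧ G.Adj c1 c2 ∧ G.Adj c2 c3 ∧ G.Adj c3 c4 ∧ G.Adj c4 c0 ∧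
    c0 ≠ c2 ∧ c0 ≠ c3 ∧ c1 ≠ c3 ∧ c1 ≠ c4 ∧ c2 ≠ c4 ∧
    ¬G.Adj c0 c2 ∧ ¬G.Adj c0 c3 ∧ ¬G.Adj c1 c3 ∧ ¬G.Adj c1 c4 ∧ ¬G.Adj c2 c4

/-- A generalized 2-join `((X1,Y1),(X2,Y2))` of `G` separating `V1` from `V2`,
with `X1, X2, Y1, Y2` pairwise disjoint except possibly `X1` and `Y1`. -/
structure IsGen2Join [Fintype V] [DecidableEq V] (G : SimpleGraph V)
    (V1 V2 X1 Y1 X2 Y2 : Finset V) : Prop where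
  disjV : Disjoint V1 V2
  unionV : V1 ∪ V2 = Finset.univ
  subX1 : X1 ⊆ V1
  subY1 : Y1 ⊆ V1
  subX2 : X2 ⊆ V2
  subY2 : Y2 ⊆ V2
  cliqueX : G.IsClique (↑X1 ∪ ↑X2 : Set V)
  cliqueY : G.IsClique (↑Y1 ∪ ↑Y2 : Set V)
  cross : ∀ u ∈ V1, ∀ v ∈ V2, G.Adj u v → (u ∈ X1 ∧ v ∈ X2) ∨ (u ∈ Y1 ∧ v ∈ Y2)
  disjX2Y2 : Disjoint X2 Y2

/-- ω'(v): the maximum size of a clique of `H2 = G[V2 ∪ X1 ∪ Y1]` containing `v`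
and not intersecting both `X1 ∖ Y1` and `Y1 ∖ X1`. -/
noncomputable def omegaJ [DecidableEq V] (G : SimpleGraph V) (V2 X1 Y1 : Finset V) (v : V) : ℕ :=
  sSup {n | ∃ s : Finset V, G.IsNClique n s ∧ v ∈ s ∧ s ⊆ V2 ∪ X1 ∪ Y1 ∧
      ¬((∃ x ∈ s, x ∈ X1 ∧ x ∉ Y1) ∧ ∃ y ∈ s, y ∈ Y1 ∧ y ∉ X1)}

/-- γ_ℓ^j(H2) = max over `v ∈ V2 ∪ X1 ∪ Y1` of ⌈(d_G(v)+1+ω'(v))/2⌉. -/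
noncomputable def gammaLJ [DecidableEq V] (G : SimpleGraph V) (V2 X1 Y1 : Finset V) : ℕ :=
  (V2 ∪ X1 ∪ Y1).sup fun v => (degree' G v + 1 + omegaJ G V2 X1 Y1 v + 1) / 2

/-- `(G[V2], X2, Y2)` is an antihat strip. -/
def IsAntihatStripOn (G : SimpleGraph V) (V2 X2 Y2 : Finset V) : Prop :=
  ∃ (k : ℕ) (e00 : Bool) (Xd : Finset (AHV k)) (M : Set (Sym2 (AHV k))) (f : V → AHV k),
    2 ≤ k ∧ ahA (0 : Fin (k + 1)) ∉ Xd ∧ ahB (0 : Fin (k + 1)) ∉ Xd ∧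
    (∃ i j : Fin k, i ≠ j ∧ ahC i ∉ Xd ∧ ahC j ∉ Xd) ∧
    AntihatM k e00 Xd M ∧
    IsThickeningBetween (antihatH k e00 ⊔ SimpleGraph.fromEdgeSet M) M
      ((↑Xd ∪ {ahA (0 : Fin (k + 1)), ahB (0 : Fin (k + 1))} : Set (AHV k))ᶜ)
      G (↑V2 : Set V) f ∧
    (↑X2 : Set V) = {v | v ∈ V2 ∧ ∃ i : Fin (k + 1), 1 ≤ i.val ∧ f v = ahA i ∧ ahA i ∉ Xd} ∧
    (↑Y2 : Set V) = {v | v ∈ V2 ∧ ∃ i : Fin (k + 1), 1 ≤ i.val ∧ f v = ahB i ∧ ahB i ∉ Xd} ∧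
    HasInducedW5On G (↑V2 : Set V)

/-- The base graph of strange strips, on `a1=0, a2=1, b1=2, b2=3, b3=4, c1=5, c2=6`. -/
def strangeH : SimpleGraph (Fin 7) :=
  SimpleGraph.fromEdgeSet
    {s(0, 1), s(2, 3), s(2, 4), s(3, 4), s(5, 6),
     s(0, 2), s(1, 5), s(3, 5), s(4, 5), s(0, 6), s(1, 6), s(2, 6), s(3, 6)}

/-- The matching `{b3c1, b2c2}` of strange strips. -/
def strangeM : Set (Sym2 (Fin 7)) := {s(4, 5), s(3, 6)}

/-- `(G[V2], X2, Y2)` is a strange strip. -/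
def IsStrangeStripOn (G : SimpleGraph V) (V2 X2 Y2 : Finset V) : Prop :=
  ∃ f : V → Fin 7,
    IsThickeningBetween strangeH strangeM Set.univ G (↑V2 : Set V) f ∧
    (↑X2 : Set V) = {v | v ∈ V2 ∧ (f v = 0 ∨ f v = 1)} ∧
    (↑Y2 : Set V) = {v | v ∈ V2 ∧ (f v = 2 ∨ f v = 3 ∨ f v = 4)}

/-- The base graph of gear strips, on `v1, …, v10` (as `0, …, 9`). -/
def gearH : SimpleGraph (Fin 10) :=
  SimpleGraph.fromEdgeSet
    {s(0, 1), s(1, 2), s(2, 3), s(3, 4), s(4, 5), s(0, 5),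
     s(6, 0), s(6, 1), s(6, 2), s(6, 5),
     s(7, 2), s(7, 3), s(7, 4), s(7, 5), s(7, 6),
     s(8, 0), s(8, 2), s(8, 3), s(8, 5), s(8, 6), s(8, 7),
     s(9, 1), s(9, 2), s(9, 4), s(9, 5), s(9, 6), s(9, 7)}

/-- `(G[V2], X2, Y2)` is a gear strip. -/
def IsGearStripOn (G : SimpleGraph V) (V2 X2 Y2 : Finset V) : Prop :=
  ∃ (Xd : Finset (Fin 10)) (M : Set (Sym2 (Fin 10))) (f : V → Fin 10),
    Xd ⊆ {8, 9} ∧ M ⊆ {s((6 : Fin 10), 7)} ∧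
    IsThickeningBetween gearH M ((↑Xd : Set (Fin 10))ᶜ) G (↑V2 : Set V) f ∧
    (↑X2 : Set V) = {v | v ∈ V2 ∧ (f v = 0 ∨ f v = 1)} ∧
    (↑Y2 : Set V) = {v | v ∈ V2 ∧ (f v = 3 ∨ f v = 4)}

/-! ### The two exceptional three-cliqued classes -/

/-- The base graph of Exception I, on `v1, …, v8` (as `0, …, 7`);
`b` records whether `v2v5` is an edge. -/
def exIG (b : Bool) : SimpleGraph (Fin 8) :=
  SimpleGraph.fromEdgeSet
    ({s(0, 1), s(0, 2), s(0, 5), s(0, 6), s(1, 2), s(1, 3), s(2, 3), s(2, 4), s(3, 4),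
      s(3, 5), s(4, 5), s(5, 6), s(6, 7)} ∪ (if b then {s(1, 4)} else ∅))

/-- The matching of Exception I: `{v1v4, v3v6}`, plus `v2v5` when present. -/
def exIM (b : Bool) : Set (Sym2 (Fin 8)) :=
  {s(0, 3), s(2, 5)} ∪ (if b then {s(1, 4)} else ∅)

/-- The base graph of Exception II, on `v1, …, v9` (as `0, …, 8`); `b24` records
whether `v2v4` is an edge and `b75` whether `v7v5` is an edge. -/
def exIIG (b24 b75 : Bool) : SimpleGraph (Fin 9) :=
  SimpleGraph.fromEdgeSet
    ({s(0, 1), s(6, 7),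
      s(2, 3), s(2, 4), s(2, 5), s(2, 8), s(3, 4), s(3, 5), s(3, 8), s(4, 5), s(4, 8), s(5, 8),
      s(0, 2), s(0, 7), s(0, 8), s(5, 7), s(7, 8), s(1, 2), s(5, 6)}
      ∪ (if b24 then {s(1, 3)} else ∅) ∪ (if b75 then {s(4, 6)} else ∅))

/-! ### Circular interval representations -/

/-- Membership in the (closed) arc from `s` to `t` of the circle `[0,1)`,
going in increasing direction and possibly wrapping around. -/
def ArcMem (s t x : ℝ) : Prop := if s ≤ t then s ≤ x ∧ x ≤ t else (s ≤ x ∨ x ≤ t)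


universe u

/-- A convenient consequence of Tutte's theorem. -/
lemma tutte_aux {U : Type u} [Fintype U] [DecidableEq U] (Γ : SimpleGraph U)
    (heven : Even (Fintype.card U)) (hno : ∀ M : Γ.Subgraph, ¬ M.IsPerfectMatching) :
    ∃ (S R : Finset U) (ι : Type u) (lab : U → ι),
      (∀ u v, u ∉ S → v ∉ S → lab u ≠ lab v → ¬ Γ.Adj u v) ∧
      (∀ u ∈ R, u ∉ S) ∧ Set.InjOn lab R ∧ S.card + 2 ≤ R.card := by
  classical
  have h1 : ∃ u, Γ.IsTutteViolator u := by
    by_contra h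
    push Not at h
    obtain ⟨M, hM⟩ := tutte.mpr h
    exact hno M hM
  obtain ⟨u, hu⟩ := h1
  unfold IsTutteViolator at hu
  set D := ((⊤ : Γ.Subgraph).deleteVerts u) with hD
  have hverts : D.verts = uᶜ := by
    ext x; simp [hD]
  have hpar := odd_ncard_oddComponents (G := D.coe)
  have hcardV : Nat.card D.verts + u.ncard = Fintype.card U := by
    rw [Nat.card_coe_set_eq, hverts, add_comm, Set.ncard_add_ncard_compl, Nat.card_eq_fintype_card]
  have hge : u.ncard + 2 ≤ D.coe.oddComponents.ncard := by
    by_contra hlt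
    have heq : D.coe.oddComponents.ncard = u.ncard + 1 := by omega
    rw [heq] at hpar
    rw [Nat.even_iff] at heven
    simp only [Nat.odd_iff] at hpar
    omega
  let rep : D.coe.ConnectedComponent → U := fun c => (c.nonempty_supp.some : D.verts).1
  have hrep : ∀ c, ∃ h : rep c ∈ D.verts, D.coe.connectedComponentMk ⟨rep c, h⟩ = c := by
    intro c
    exact ⟨(c.nonempty_supp.some : D.verts).2, c.nonempty_supp.some_mem⟩
  let lab : U → Option D.coe.ConnectedComponent := fun x =>
    if h : x ∈ D.verts then some (D.coe.connectedComponentMk ⟨x, h⟩) else none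
  have hlabrep : ∀ c, lab (rep c) = some c := by
    intro c
    obtain ⟨h, h'⟩ := hrep c
    simp only [lab, h, dif_pos, h']
  have hinj : Function.Injective rep := by
    intro c d hcd
    have := hlabrep c
    rw [hcd, hlabrep d] at this
    exact (Option.some.inj this).symm
  refine ⟨u.toFinset, (rep '' D.coe.oddComponents).toFinset, _, lab, ?_, ?_, ?_, ?_⟩
  · intro x y hx hy hl hadj
    apply hl
    have hx' : x ∈ D.verts := by rw [hverts]; simpa using hx
    have hy' : y ∈ D.verts := by rw [hverts]; simpa using hy
    simp only [lab, hx', hy', dif_pos, Option.some.injEq]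
    apply ConnectedComponent.sound
    apply Adj.reachable
    have hx2 : x ∉ u := by simpa using hx
    have hy2 : y ∉ u := by simpa using hy
    simp [hD, hx2, hy2, hadj]
  · intro x hx
    simp only [Set.mem_toFinset, Set.mem_image] at hx ⊢
    obtain ⟨c, -, rfl⟩ := hx
    obtain ⟨h, -⟩ := hrep c
    rw [hverts] at h
    exact h
  · intro x hx y hy hxy
    simp only [Set.coe_toFinset, Set.mem_image] at hx hy
    obtain ⟨c, -, rfl⟩ := hx
    obtain ⟨d, -, rfl⟩ := hy
    rw [hlabrep, hlabrep] at hxy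
    rw [Option.some.inj hxy]
  · rw [← Set.ncard_eq_toFinset_card', ← Set.ncard_eq_toFinset_card',
      Set.ncard_image_of_injective _ hinj]
    exact hge

/-- In a graph without triads, every nonempty set `S` has a vertex `v` and a clique `T ∋ v` in `S`
with `|N(v) ∩ S| + 1 + |T| ≥ |S|`. -/
lemma exists_good_vertex {W : Type*} [Fintype W] [DecidableEq W] (J : SimpleGraph W)
    [DecidableRel J.Adj]
    (hα : ∀ a b c, a ≠ b → a ≠ c → b ≠ c → J.Adj a b ∨ J.Adj a c ∨ J.Adj b c)
    (S : Finset W) (hS : S.Nonempty) :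
    ∃ v ∈ S, ∃ T ⊆ S, v ∈ T ∧ J.IsClique (T : Set W) ∧
      S.card ≤ (S.filter (J.Adj v)).card + 1 + T.card := by
  obtain ⟨u, hu, hmin⟩ := S.exists_min_image (fun v => (S.filter (J.Adj v)).card) hS
  have hcnt : (S.filter (J.Adj u)).card + (S.filter (fun w => ¬ J.Adj u w)).card = S.card :=
    Finset.card_filter_add_card_filter_not _
  have hins : ((S.filter (fun w => ¬ J.Adj u w)).erase u).card + 1
      = (S.filter (fun w => ¬ J.Adj u w)).card := by
    apply Finset.card_erase_add_one
    simp [hu]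
  by_cases hne : ((S.filter (fun w => ¬ J.Adj u w)).erase u).Nonempty
  · obtain ⟨v, hv⟩ := hne
    have hv' := hv
    simp only [Finset.mem_erase, Finset.mem_filter] at hv'
    refine ⟨v, hv'.2.1, (S.filter (fun w => ¬ J.Adj u w)).erase u, ?_, hv, ?_, ?_⟩
    · intro x hx
      simp only [Finset.mem_erase, Finset.mem_filter] at hx
      exact hx.2.1
    · intro x hx y hy hxy
      simp only [Finset.coe_erase, Finset.coe_filter, Set.mem_sdiff, Set.mem_ofPred_eq,
        Set.mem_singleton_iff] at hx hy
      rcases hα u x y (Ne.symm hx.2) (Ne.symm hy.2) hxy with h | h | h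
      · exact absurd h hx.1.2
      · exact absurd h hy.1.2
      · exact h
    · have := hmin v hv'.2.1
      omega
  · refine ⟨u, hu, {u}, by simpa using hu, by simp, by simp, ?_⟩
    rw [Finset.not_nonempty_iff_eq_empty] at hne
    rw [hne] at hins
    simp only [Finset.card_empty] at hins
    omega

/-- The local strengthening of Reed's conjecture for graphs without triads. -/
lemma colorable_of_no_triad {W : Type*} [Fintype W] [DecidableEq W] (J : SimpleGraph W)
    [DecidableRel J.Adj]
    (hα : ∀ a b c, a ≠ b → a ≠ c → b ≠ c → J.Adj a b ∨ J.Adj a c ∨ J.Adj b c) (l : ℕ)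
    (h : ∀ v, ∀ T : Finset W, v ∈ T → J.IsClique (T : Set W) →
      (Finset.univ.filter (J.Adj v)).card + 1 + T.card ≤ 2 * l) : J.Colorable l := by
  have hn : Fintype.card W ≤ 2 * l := by
    rcases (Finset.univ : Finset W).eq_empty_or_nonempty with he | hne
    · have : Fintype.card W = 0 := by rw [← Finset.card_univ, he]; rfl
      omega
    · obtain ⟨v, -, T, -, hvT, hT, hc⟩ := exists_good_vertex J hα Finset.univ hne
      have := h v T hvT hT
      rw [Finset.card_univ] at hc
      omega
  obtain ⟨d, hd⟩ := Nat.exists_eq_add_of_le hn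
  let Γ : SimpleGraph (W ⊕ Fin d) :=
    { Adj := fun x y => x ≠ y ∧ ∀ a b, x = Sum.inl a → y = Sum.inl b → ¬ J.Adj a b
      symm := ⟨fun x y hxy => ⟨hxy.1.symm, fun a b ha hb hab => hxy.2 b a hb ha hab.symm⟩⟩
      loopless := ⟨fun x hx => hx.1 rfl⟩ }
  have hcard : Fintype.card (W ⊕ Fin d) = 2 * l := by simp [hd]
  by_cases hM : ∃ M : Γ.Subgraph, M.IsPerfectMatching
  · obtain ⟨M, hM⟩ := hM
    rw [Subgraph.isPerfectMatching_iff] at hM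
    choose p hp hpu using hM
    have hpp : ∀ x, p (p x) = x := fun x => ((hpu (p x) x (hp x).symm)).symm
    have hpne : ∀ x, p x ≠ x := fun x => ((hp x).adj_sub.ne).symm
    let e : W ⊕ Fin d → Sym2 (W ⊕ Fin d) := fun x => s(x, p x)
    have hfib : ∀ z ∈ Finset.univ.image e, 2 ≤ (Finset.univ.filter (fun x => e x = z)).card := by
      intro z hz
      obtain ⟨x, -, rfl⟩ := Finset.mem_image.mp hz
      rw [← Finset.card_pair (hpne x).symm]
      apply Finset.card_le_card
      intro y hy
      simp only [Finset.mem_insert, Finset.mem_singleton] at hy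
      simp only [Finset.mem_filter, Finset.mem_univ, true_and, e]
      rcases hy with rfl | rfl
      · rfl
      · rw [hpp]; exact Sym2.eq_swap
    have hle : (Finset.univ.image e).card * 2 ≤ (Finset.univ : Finset (W ⊕ Fin d)).card := by
      rw [Finset.card_eq_sum_card_image e Finset.univ, ← smul_eq_mul]
      exact Finset.card_nsmul_le_sum _ _ _ hfib
    rw [Finset.card_univ, hcard] at hle
    have hcl : J.Colorable (Fintype.card (Finset.univ.image e : Finset _)) := by
      refine Coloring.colorable (Coloring.mk (fun w => ⟨e (Sum.inl w), by simp⟩) ?_)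
      intro v w hvw heq
      simp only [Subtype.mk.injEq, e, Sym2.eq_iff] at heq
      rcases heq with ⟨h1, -⟩ | ⟨h1, h2⟩
      · exact hvw.ne (Sum.inl.inj h1)
      · have hadj := (hp (Sum.inl v)).adj_sub
        rw [h2] at hadj
        exact hadj.2 v w rfl rfl hvw
    refine hcl.mono ?_
    rw [Fintype.card_coe]
    omega
  · push Not at hM
    exfalso
    obtain ⟨S, R, ι, lab, hlab, hRS, hinj, hSR⟩ := tutte_aux Γ (by rw [hcard]; simp) hM
    -- all the universal vertices lie in `S`
    have huniv : ∀ i : Fin d, Sum.inr i ∈ S := by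
      intro i
      by_contra hi
      have : R.card ≤ 1 := by
        rw [Finset.card_le_one]
        have key : ∀ x ∈ R, lab x = lab (Sum.inr i) := by
          intro x hx
          by_contra hne
          refine hlab x (Sum.inr i) (hRS x hx) hi hne ⟨?_, ?_⟩
          · rintro rfl; exact hne rfl
          · intro a b _ hb; cases hb
        intro x hx y hy
        exact hinj hx hy ((key x hx).trans (key y hy).symm)
      omega
    let S' : Finset W := Finset.univ.filter (fun w => Sum.inl w ∈ S)
    let R' : Finset W := Finset.univ.filter (fun w => Sum.inl w ∈ R)
    have hScard : S.card = S'.card + d := by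
      have : S = S'.disjSum (Finset.univ : Finset (Fin d)) := by
        ext x
        rcases x with x | x <;> simp [S', huniv]
      rw [this, Finset.card_disjSum]; simp
    have hRcard : R.card = R'.card := by
      have : R = R'.disjSum (∅ : Finset (Fin d)) := by
        ext x
        rcases x with x | x
        · simp [R']
        · simp only [Finset.inr_mem_disjSum, Finset.notMem_empty, iff_false]
          exact fun hx => hRS _ hx (huniv x)
      rw [this, Finset.card_disjSum]; simp
    have hadj : ∀ v w, v ∉ S' → w ∉ S' → lab (Sum.inl v) ≠ lab (Sum.inl w) → J.Adj v w := by
      intro v w hv hw hne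
      by_contra hna
      refine hlab _ _ (by simpa [S'] using hv) (by simpa [S'] using hw) hne ⟨?_, ?_⟩
      · intro h; rw [h] at hne; exact hne rfl
      · intro a b ha hb
        rw [← Sum.inl.inj ha, ← Sum.inl.inj hb]; exact hna
    have hR'S : ∀ w ∈ R', w ∉ S' := by
      intro w hw hw'
      simp only [R', S', Finset.mem_filter, Finset.mem_univ, true_and] at hw hw'
      exact hRS _ hw hw'
    have hR'inj : ∀ v ∈ R', ∀ w ∈ R', lab (Sum.inl v) = lab (Sum.inl w) → v = w := by
      intro v hv w hw hvw
      simp only [R', Finset.mem_filter, Finset.mem_univ, true_and] at hv hw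
      exact Sum.inl.inj (hinj hv hw hvw)
    obtain ⟨q, hq⟩ : R'.Nonempty := by
      rw [← Finset.card_pos]; omega
    classical
    let K : Finset W := S'ᶜ.filter (fun w => lab (Sum.inl w) = lab (Sum.inl q))
    have hKmem : ∀ w, w ∈ K ↔ w ∉ S' ∧ lab (Sum.inl w) = lab (Sum.inl q) := by
      intro w; simp [K]
    obtain ⟨v, hvK, T, hTK, hvT, hT, hc⟩ := exists_good_vertex J hα K
      ⟨q, (hKmem q).2 ⟨hR'S q hq, rfl⟩⟩
    have hdisj : Disjoint T (R'.erase q) := by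
      rw [Finset.disjoint_left]
      intro x hx hx'
      have h1 := (hKmem x).1 (hTK hx)
      rw [Finset.mem_erase] at hx'
      exact hx'.1 (hR'inj x hx'.2 q hq h1.2)
    have hTR : J.IsClique ((T ∪ R'.erase q : Finset W) : Set W) := by
      intro x hx y hy hxy
      simp only [Finset.coe_union, Set.mem_union, Finset.mem_coe, Finset.mem_erase] at hx hy
      have key : ∀ x y, x ∈ T → y ≠ q → y ∈ R' → J.Adj x y := by
        intro x y hx hyq hy
        have h1 := (hKmem x).1 (hTK hx)
        refine hadj x y h1.1 (hR'S y hy) ?_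
        rw [h1.2]
        exact fun h => hyq (hR'inj q hq y hy h).symm
      rcases hx with hx | hx <;> rcases hy with hy | hy
      · exact hT hx hy hxy
      · exact key x y hx hy.1 hy.2
      · exact (key y x hy hx.1 hx.2).symm
      · exact hadj x y (hR'S x hx.2) (hR'S y hy.2) (fun h => hxy (hR'inj x hx.2 y hy.2 h))
    have hb := h v (T ∪ R'.erase q) (Finset.mem_union_left _ hvT) hTR
    rw [Finset.card_union_of_disjoint hdisj, Finset.card_erase_of_mem hq] at hb
    have hdeg : (K.filter (J.Adj v)).card + (S'ᶜ \ K).card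
        ≤ (Finset.univ.filter (J.Adj v)).card := by
      rw [← Finset.card_union_of_disjoint]
      · apply Finset.card_le_card
        intro x hx
        simp only [Finset.mem_union, Finset.mem_filter, Finset.mem_sdiff, Finset.mem_compl] at hx
        simp only [Finset.mem_filter, Finset.mem_univ, true_and]
        rcases hx with hx | hx
        · exact hx.2
        · have hv := (hKmem v).1 hvK
          refine hadj v x hv.1 hx.1 ?_
          rw [hv.2]
          intro hh
          exact hx.2 ((hKmem x).2 ⟨hx.1, hh.symm⟩)
      · rw [Finset.disjoint_left]
        intro x hx hx'
        exact (Finset.mem_sdiff.1 hx').2 (Finset.mem_filter.1 hx).1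
    have hKS : (S'ᶜ \ K).card + K.card = S'ᶜ.card :=
      Finset.card_sdiff_add_card_eq_card (Finset.filter_subset _ _)
    have hScomp : S'.card + S'ᶜ.card = Fintype.card W := Finset.card_add_card_compl S'
    have hRpos : 0 < R'.card := Finset.card_pos.2 ⟨q, hq⟩
    omega


/-- Combining two colourings by a permutation of colours. -/
lemma exists_perm (l : ℕ) (S1 S2 T1 T2 : Finset (Fin l))
    (h1 : S1.card + T1.card ≤ l) (h2 : S2.card + T2.card ≤ l)
    (hm : (T1 ∩ T2).card + (S1 ∪ S2).card ≤ l)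
    (hq : (T1 ∪ T2).card + (S1 ∩ S2).card ≤ l) :
    ∃ π : Fin l → Fin l, Function.Injective π ∧ (∀ g ∈ T1, π g ∉ S1) ∧ (∀ g ∈ T2, π g ∉ S2) := by
  have hall := (Finset.all_card_le_biUnion_card_iff_exists_injective
    (fun g : Fin l => Finset.univ.filter (fun x : Fin l => (g ∈ T1 → x ∉ S1) ∧ (g ∈ T2 → x ∉ S2)))).1
  obtain ⟨π, hπ, hπ'⟩ := hall (by
    intro U
    have hcompl : ∀ S : Finset (Fin l), S.card + Sᶜ.card = l := by
      intro S; rw [Finset.card_add_card_compl]; simp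
    have fin : ∀ T S : Finset (Fin l), U ⊆ T → T.card + S.card ≤ l →
        (∀ x, x ∉ S → ∃ g ∈ U, (g ∈ T1 → x ∉ S1) ∧ (g ∈ T2 → x ∉ S2)) →
        U.card ≤ (U.biUnion (fun g : Fin l => Finset.univ.filter
          (fun x : Fin l => (g ∈ T1 → x ∉ S1) ∧ (g ∈ T2 → x ∉ S2)))).card := by
      intro T S hUT hTS hx
      have c1 := Finset.card_le_card hUT
      have c2 := hcompl S
      have c3 : Sᶜ.card ≤ (U.biUnion (fun g : Fin l => Finset.univ.filter
          (fun x : Fin l => (g ∈ T1 → x ∉ S1) ∧ (g ∈ T2 → x ∉ S2)))).card := by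
        apply Finset.card_le_card
        intro x hxS
        rw [Finset.mem_compl] at hxS
        obtain ⟨g, hg, hgx⟩ := hx x hxS
        rw [Finset.mem_biUnion]
        exact ⟨g, hg, by simpa using hgx⟩
      omega
    rcases U.eq_empty_or_nonempty with rfl | ⟨g0, hg0⟩
    · simp
    by_cases hA : ∃ g ∈ U, g ∉ T1
    · obtain ⟨g, hg, hgT⟩ := hA
      by_cases hB : ∃ g ∈ U, g ∉ T2
      · obtain ⟨g', hg', hgT'⟩ := hB
        by_cases hC : ∃ g ∈ U, g ∉ T1 ∧ g ∉ T2
        · obtain ⟨g3, hg3, h31, h32⟩ := hC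
          refine fin Finset.univ ∅ (Finset.subset_univ _) (by simp) ?_
          intro x _
          exact ⟨g3, hg3, fun h => absurd h h31, fun h => absurd h h32⟩
        · refine fin (T1 ∪ T2) (S1 ∩ S2) ?_ hq ?_
          · intro y hy
            by_contra hy'
            rw [Finset.mem_union, not_or] at hy'
            exact hC ⟨y, hy, hy'⟩
          · intro x hx
            rw [Finset.mem_inter, not_and_or] at hx
            rcases hx with hx | hx
            · exact ⟨g', hg', fun _ => hx, fun h => absurd h hgT'⟩
            · exact ⟨g, hg, fun h => absurd h hgT, fun _ => hx⟩
      · push Not at hB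
        refine fin T2 S2 hB (by omega) ?_
        intro x hx
        exact ⟨g, hg, fun h => absurd h hgT, fun _ => hx⟩
    · push Not at hA
      by_cases hB : ∃ g ∈ U, g ∉ T2
      · obtain ⟨g', hg', hgT'⟩ := hB
        refine fin T1 S1 hA (by omega) ?_
        intro x hx
        exact ⟨g', hg', fun _ => hx, fun h => absurd h hgT'⟩
      · push Not at hB
        refine fin (T1 ∩ T2) (S1 ∪ S2) ?_ hm ?_
        · intro y hy; exact Finset.mem_inter.2 ⟨hA y hy, hB y hy⟩
        · intro x hx
          rw [Finset.mem_union, not_or] at hx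
          exact ⟨g0, hg0, fun _ => hx.1, fun _ => hx.2⟩)
  refine ⟨π, hπ, ?_, ?_⟩
  · intro g hg
    have := hπ' g
    simp only [Finset.mem_filter, Finset.mem_univ, true_and] at this
    exact this.1 hg
  · intro g hg
    have := hπ' g
    simp only [Finset.mem_filter, Finset.mem_univ, true_and] at this
    exact this.2 hg

/-- `φ` is a proper colouring on the vertex set `S`. -/
def ProperOn {V : Type*} {l : ℕ} (G : SimpleGraph V) (S : Finset V) (φ : V → Fin l) : Prop :=
  ∀ u ∈ S, ∀ v ∈ S, G.Adj u v → φ u ≠ φ v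

lemma ProperOn.card_image {V : Type*} [DecidableEq V] {l : ℕ} {G : SimpleGraph V} {S : Finset V}
    {φ : V → Fin l} (h : ProperOn G S φ) {X : Finset V} (hX : X ⊆ S) (hc : G.IsClique (X : Set V)) :
    (X.image φ).card = X.card := by
  apply Finset.card_image_of_injOn
  intro u hu v hv huv
  by_contra hne
  exact h u (hX hu) v (hX hv) (hc hu hv hne) huv

/-- Either a vertex of `X` whose colour appears on `Y` may be recoloured so as to decrease the
number of colours common to `X` and `Y`, or it sees all colours appearing on neither. -/
lemma recolor {V : Type*} [DecidableEq V] {l : ℕ} {G : SimpleGraph V} {S X Y : Finset V}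
    {φ : V → Fin l} (h : ProperOn G S φ) (hXS : X ⊆ S) (hXc : G.IsClique (X : Set V))
    {v : V} (hvX : v ∈ X) (hvY : v ∉ Y) (hφ : φ v ∈ Y.image φ) :
    (∃ φ' : V → Fin l, ProperOn G S φ' ∧
      (X.image φ' ∩ Y.image φ').card < (X.image φ ∩ Y.image φ).card ∧
      (X.image φ ∩ Y.image φ).card ≤ (X.image φ' ∩ Y.image φ').card + 1) ∨
    ∃ D : Finset V, D ⊆ S ∧ (∀ u ∈ D, G.Adj v u ∧ φ u ∉ X.image φ ∪ Y.image φ) ∧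
      l ≤ D.card + (X.image φ ∪ Y.image φ).card := by
  classical
  by_cases hall : ∀ g : Fin l, g ∉ X.image φ ∪ Y.image φ → ∃ u ∈ S, G.Adj v u ∧ φ u = g
  · right
    refine ⟨S.filter (fun u => G.Adj v u ∧ φ u ∉ X.image φ ∪ Y.image φ),
      Finset.filter_subset _ _, ?_, ?_⟩
    · intro u hu
      exact (Finset.mem_filter.1 hu).2
    · have h1 : (X.image φ ∪ Y.image φ)ᶜ ⊆
          (S.filter (fun u => G.Adj v u ∧ φ u ∉ X.image φ ∪ Y.image φ)).image φ := by
        intro g hg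
        rw [Finset.mem_compl] at hg
        obtain ⟨u, hu, hadj, rfl⟩ := hall g hg
        exact Finset.mem_image_of_mem _ (Finset.mem_filter.2 ⟨hu, hadj, hg⟩)
      have h2 := (Finset.card_le_card h1).trans Finset.card_image_le
      have h3 := Finset.card_add_card_compl (X.image φ ∪ Y.image φ)
      rw [Fintype.card_fin] at h3
      omega
  · left
    push Not at hall
    obtain ⟨g, hg, hgS⟩ := hall
    rw [Finset.mem_union, not_or] at hg
    have hother : ∀ u, u ≠ v → Function.update φ v g u = φ u := fun u hu =>
      Function.update_of_ne hu _ _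
    have hself : Function.update φ v g v = g := Function.update_self _ _ _
    have hY : Y.image (Function.update φ v g) = Y.image φ := by
      apply Finset.image_congr
      intro u hu
      exact hother u (fun h => hvY (h ▸ hu))
    have hX1 : X.image (Function.update φ v g) ∩ Y.image φ = (X.image φ ∩ Y.image φ).erase (φ v) := by
      ext c
      simp only [Finset.mem_inter, Finset.mem_erase]
      constructor
      · rintro ⟨hc, hcY⟩
        obtain ⟨u, hu, rfl⟩ := Finset.mem_image.1 hc
        by_cases huv : u = v
        · subst huv
          rw [hself] at hcY
          exact absurd hcY hg.2
        · rw [hother u huv] at hcY ⊢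
          refine ⟨?_, Finset.mem_image_of_mem _ hu, hcY⟩
          exact h u (hXS hu) v (hXS hvX) (hXc hu hvX huv)
      · rintro ⟨hne, hc, hcY⟩
        obtain ⟨u, hu, rfl⟩ := Finset.mem_image.1 hc
        refine ⟨?_, hcY⟩
        have huv : u ≠ v := by rintro rfl; exact hne rfl
        rw [← hother u huv]
        exact Finset.mem_image_of_mem _ hu
    have hmem : φ v ∈ X.image φ ∩ Y.image φ :=
      Finset.mem_inter.2 ⟨Finset.mem_image_of_mem _ hvX, hφ⟩
    have hcard := Finset.card_erase_add_one hmem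
    refine ⟨Function.update φ v g, ?_, ?_, ?_⟩
    · intro u hu w hw huw
      by_cases h1 : u = v
      · subst h1
        rw [hself, hother w huw.ne.symm]
        exact fun hc => hgS w hw huw hc.symm
      · by_cases h2 : w = v
        · subst h2
          rw [hself, hother u h1]
          exact hgS u hu huw.symm
        · rw [hother u h1, hother w h2]
          exact h u hu w hw huw
    · rw [hY, hX1]; omega
    · rw [hY, hX1]; omega

/-- Choose a colouring with as small an overlap as possible. -/
lemma exists_min_overlap {V : Type*} {l : ℕ} (P : (V → Fin l) → Prop) (m : (V → Fin l) → ℕ)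
    (h : ∃ φ, P φ) : ∃ φ, P φ ∧ ∀ φ', P φ' → m φ ≤ m φ' := by
  obtain ⟨φ, hφ, hmin⟩ := (measure m).wf.has_min {φ | P φ} h
  exact ⟨φ, hφ, fun χ hχ => not_lt.1 (hmin χ hχ)⟩

/-- The extension argument. -/
lemma combine {V : Type*} [Fintype V] [DecidableEq V] (G : SimpleGraph V)
    (V1 V2 X1 Y1 X2 Y2 : Finset V) (hj : IsGen2Join G V1 V2 X1 Y1 X2 Y2) (l : ℕ)
    (hXb : ∀ v ∈ X1 ∪ X2, ∀ D : Finset V, (∀ u ∈ D, G.Adj v u ∧ u ∉ X1 ∪ X2) →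
      D.card + 2 * X1.card + 2 * X2.card ≤ 2 * l)
    (hYb : ∀ v ∈ Y1 ∪ Y2, ∀ D : Finset V, (∀ u ∈ D, G.Adj v u ∧ u ∉ Y1 ∪ Y2) →
      D.card + 2 * Y1.card + 2 * Y2.card ≤ 2 * l)
    (hV1 : ∃ φ : V → Fin l, ProperOn G V1 φ)
    (hV2 : ∃ φ : V → Fin l, ProperOn G (V2 ∪ (X1 ∩ Y1)) φ) :
    G.Colorable l := by
  have hX1c : G.IsClique (X1 : Set V) := hj.cliqueX.subset Set.subset_union_left
  have hX2c : G.IsClique (X2 : Set V) := hj.cliqueX.subset Set.subset_union_right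
  have hY1c : G.IsClique (Y1 : Set V) := hj.cliqueY.subset Set.subset_union_left
  have hY2c : G.IsClique (Y2 : Set V) := hj.cliqueY.subset Set.subset_union_right
  have hd12 : ∀ v, v ∈ V1 → v ∉ V2 := fun v h h' => Finset.disjoint_left.1 hj.disjV h h'
  have hXl : X1.card + X2.card ≤ l := by
    rcases (X1 ∪ X2).eq_empty_or_nonempty with he | ⟨v, hv⟩
    · rw [Finset.union_eq_empty] at he
      simp [he.1, he.2]
    · have := hXb v hv ∅ (by simp)
      simp only [Finset.card_empty] at this
      omega
  have hYl : Y1.card + Y2.card ≤ l := by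
    rcases (Y1 ∪ Y2).eq_empty_or_nonempty with he | ⟨v, hv⟩
    · rw [Finset.union_eq_empty] at he
      simp [he.1, he.2]
    · have := hYb v hv ∅ (by simp)
      simp only [Finset.card_empty] at this
      omega
  obtain ⟨φ, hφ, hφmin⟩ := exists_min_overlap (fun φ : V → Fin l => ProperOn G V1 φ)
    (fun φ => (X1.image φ ∩ Y1.image φ).card) hV1
  have cX1 := hφ.card_image hj.subX1 hX1c
  have cY1 := hφ.card_image hj.subY1 hY1c
  have cU1 := Finset.card_union_add_card_inter (X1.image φ) (Y1.image φ)
  have cV2 : ∀ ψ : V → Fin l, ProperOn G V2 ψ →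
      (X2.image ψ ∪ Y2.image ψ).card + (X2.image ψ ∩ Y2.image ψ).card = X2.card + Y2.card := by
    intro ψ hψ
    rw [Finset.card_union_add_card_inter, hψ.card_image hj.subX2 hX2c,
      hψ.card_image hj.subY2 hY2c]
  -- the initial colouring of `G2`
  have hinit : ∃ ψ : V → Fin l, ProperOn G V2 ψ ∧
      (X2.image ψ ∪ Y2.image ψ).card + (X1.image φ ∩ Y1.image φ).card ≤ l := by
    obtain ⟨ψ, hψ⟩ := hV2
    have hψ2 : ProperOn G V2 ψ := fun u hu v hv =>
      hψ u (Finset.mem_union_left _ hu) v (Finset.mem_union_left _ hv)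
    refine ⟨ψ, hψ2, ?_⟩
    by_cases hz : ∀ v ∈ X1, ∀ w ∈ Y1, φ v = φ w → v = w
    · -- the common colours all come from `X1 ∩ Y1`
      have hk : (X1.image φ ∩ Y1.image φ).card ≤ (X1 ∩ Y1).card := by
        refine (Finset.card_le_card ?_).trans (Finset.card_image_le (f := φ))
        intro c hc
        rw [Finset.mem_inter] at hc
        obtain ⟨v, hv, hvc⟩ := Finset.mem_image.1 hc.1
        obtain ⟨w, hw, hwc⟩ := Finset.mem_image.1 hc.2
        have : v = w := hz v hv w hw (hvc.trans hwc.symm)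
        subst this
        exact Finset.mem_image.2 ⟨v, Finset.mem_inter.2 ⟨hv, hw⟩, hvc⟩
      have hZ : ((X1 ∩ Y1).image ψ).card = (X1 ∩ Y1).card := by
        refine hψ.card_image Finset.subset_union_right ?_
        refine hX1c.subset ?_
        intro x hx
        exact (Finset.mem_inter.1 hx).1
      have hdis : Disjoint (X2.image ψ ∪ Y2.image ψ) ((X1 ∩ Y1).image ψ) := by
        rw [Finset.disjoint_left]
        intro c hc hc'
        obtain ⟨z, hz, rfl⟩ := Finset.mem_image.1 hc'
        have hzXY := Finset.mem_inter.1 hz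
        rw [Finset.mem_union] at hc
        rcases hc with hc | hc
        · obtain ⟨a, ha, hac⟩ := Finset.mem_image.1 hc
          refine hψ a (Finset.mem_union_left _ (hj.subX2 ha)) z (Finset.mem_union_right _ hz) ?_ hac
          refine hj.cliqueX (Or.inr ha) (Or.inl hzXY.1) ?_
          rintro rfl
          exact hd12 a (hj.subX1 hzXY.1) (hj.subX2 ha)
        · obtain ⟨a, ha, hac⟩ := Finset.mem_image.1 hc
          refine hψ a (Finset.mem_union_left _ (hj.subY2 ha)) z (Finset.mem_union_right _ hz) ?_ hac
          refine hj.cliqueY (Or.inr ha) (Or.inl hzXY.2) ?_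
          rintro rfl
          exact hd12 a (hj.subX1 hzXY.1) (hj.subY2 ha)
      have hle := Finset.card_le_univ ((X2.image ψ ∪ Y2.image ψ) ∪ ((X1 ∩ Y1).image ψ))
      rw [Finset.card_union_of_disjoint hdis, Fintype.card_fin] at hle
      omega
    · push Not at hz
      obtain ⟨v, hv, w, hw, hvw, hne⟩ := hz
      have hvY : v ∉ Y1 := fun h =>
        hφ v (hj.subX1 hv) w (hj.subY1 hw) (hY1c h hw hne) hvw
      have hwX : w ∉ X1 := fun h =>
        hφ v (hj.subX1 hv) w (hj.subY1 hw) (hX1c hv h hne) hvw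
      have e1 : 2 * X1.card + 2 * X2.card ≤ l + (X1.image φ ∪ Y1.image φ).card := by
        rcases recolor hφ hj.subX1 hX1c hv hvY (hvw ▸ Finset.mem_image_of_mem _ hw) with
          ⟨φ', hφ', hlt, -⟩ | ⟨D, hDS, hD, hDc⟩
        · have := hφmin φ' hφ'
          omega
        · have := hXb v (Finset.mem_union_left _ hv) D (by
            intro u hu
            refine ⟨(hD u hu).1, ?_⟩
            rw [Finset.mem_union, not_or]
            exact ⟨fun h => (hD u hu).2 (Finset.mem_union_left _ (Finset.mem_image_of_mem _ h)),
              fun h => hd12 u (hDS hu) (hj.subX2 h)⟩)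
          omega
      have e2 : 2 * Y1.card + 2 * Y2.card ≤ l + (X1.image φ ∪ Y1.image φ).card := by
        rcases recolor hφ hj.subY1 hY1c hw hwX (hvw ▸ Finset.mem_image_of_mem _ hv) with
          ⟨φ', hφ', hlt, -⟩ | ⟨D, hDS, hD, hDc⟩
        · have := hφmin φ' hφ'
          rw [Finset.inter_comm, Finset.inter_comm (Y1.image φ)] at hlt
          omega
        · have := hYb w (Finset.mem_union_left _ hw) D (by
            intro u hu
            refine ⟨(hD u hu).1, ?_⟩
            rw [Finset.mem_union, not_or]
            exact ⟨fun h => (hD u hu).2 (Finset.mem_union_left _ (Finset.mem_image_of_mem _ h)),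
              fun h => hd12 u (hDS hu) (hj.subY2 h)⟩)
          rw [Finset.union_comm] at hDc
          omega
      have := cV2 ψ hψ2
      omega
  obtain ⟨ψ, ⟨hψ, hψq⟩, hψmin⟩ := exists_min_overlap (fun ψ : V → Fin l => ProperOn G V2 ψ ∧
      (X2.image ψ ∪ Y2.image ψ).card + (X1.image φ ∩ Y1.image φ).card ≤ l)
    (fun ψ => (X2.image ψ ∩ Y2.image ψ).card) hinit
  have cX2 := hψ.card_image hj.subX2 hX2c
  have cY2 := hψ.card_image hj.subY2 hY2c
  have hm : (X2.image ψ ∩ Y2.image ψ).card + (X1.image φ ∪ Y1.image φ).card ≤ l := by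
    by_contra hcon
    have hUl := Finset.card_le_univ (X1.image φ ∪ Y1.image φ)
    rw [Fintype.card_fin] at hUl
    obtain ⟨c, hc⟩ : (X2.image ψ ∩ Y2.image ψ).Nonempty := by
      rw [← Finset.card_pos]; omega
    rw [Finset.mem_inter] at hc
    obtain ⟨a, ha, hac⟩ := Finset.mem_image.1 hc.1
    obtain ⟨b, hb, hbc⟩ := Finset.mem_image.1 hc.2
    have haY : a ∉ Y2 := Finset.disjoint_left.1 hj.disjX2Y2 ha
    have hbX : b ∉ X2 := Finset.disjoint_right.1 hj.disjX2Y2 hb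
    have cψ := cV2 ψ hψ
    have e1 : 2 * X1.card + 2 * X2.card ≤ l + (X2.image ψ ∪ Y2.image ψ).card := by
      rcases recolor hψ hj.subX2 hX2c ha haY (hac ▸ hc.2) with
        ⟨ψ', hψ', hlt, hle⟩ | ⟨D, hDS, hD, hDc⟩
      · have c' := cV2 ψ' hψ'
        have := hψmin ψ' ⟨hψ', by omega⟩
        omega
      · have := hXb a (Finset.mem_union_right _ ha) D (by
          intro u hu
          refine ⟨(hD u hu).1, ?_⟩
          rw [Finset.mem_union, not_or]
          exact ⟨fun h => hd12 u (hj.subX1 h) (hDS hu),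
            fun h => (hD u hu).2 (Finset.mem_union_left _ (Finset.mem_image_of_mem _ h))⟩)
        omega
    have e2 : 2 * Y1.card + 2 * Y2.card ≤ l + (X2.image ψ ∪ Y2.image ψ).card := by
      rcases recolor hψ hj.subY2 hY2c hb hbX (hbc ▸ hc.1) with
        ⟨ψ', hψ', hlt, hle⟩ | ⟨D, hDS, hD, hDc⟩
      · have c' := cV2 ψ' hψ'
        rw [Finset.inter_comm, Finset.inter_comm (Y2.image ψ)] at hlt
        rw [Finset.inter_comm, Finset.inter_comm (Y2.image ψ')] at hle
        have := hψmin ψ' ⟨hψ', by omega⟩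
        omega
      · have := hYb b (Finset.mem_union_right _ hb) D (by
          intro u hu
          refine ⟨(hD u hu).1, ?_⟩
          rw [Finset.mem_union, not_or]
          exact ⟨fun h => hd12 u (hj.subY1 h) (hDS hu),
            fun h => (hD u hu).2 (Finset.mem_union_left _ (Finset.mem_image_of_mem _ h))⟩)
        rw [Finset.union_comm] at hDc
        omega
    omega
  obtain ⟨π, hπ, hπX, hπY⟩ := exists_perm l (X1.image φ) (Y1.image φ) (X2.image ψ) (Y2.image ψ)
    (by omega) (by omega) hm hψq
  have hcross : ∀ u ∈ V1, ∀ v ∈ V2, G.Adj u v → φ u ≠ π (ψ v) := by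
    intro u hu v hv huv heq
    rcases hj.cross u hu v hv huv with ⟨h1, h2⟩ | ⟨h1, h2⟩
    · exact hπX (ψ v) (Finset.mem_image_of_mem _ h2) (heq ▸ Finset.mem_image_of_mem _ h1)
    · exact hπY (ψ v) (Finset.mem_image_of_mem _ h2) (heq ▸ Finset.mem_image_of_mem _ h1)
  have hV : ∀ v, v ∉ V1 → v ∈ V2 := by
    intro v hv
    have : v ∈ V1 ∪ V2 := hj.unionV ▸ Finset.mem_univ v
    exact (Finset.mem_union.1 this).resolve_left hv
  refine ⟨Coloring.mk (fun v => if v ∈ V1 then φ v else π (ψ v)) ?_⟩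
  intro u v huv
  by_cases hu : u ∈ V1 <;> by_cases hv : v ∈ V1
  · simpa [hu, hv] using hφ u hu v hv huv
  · simpa [hu, hv] using hcross u hu v (hV v hv) huv
  · simpa [hu, hv] using (hcross v hv u (hV u hu) huv.symm).symm
  · simp only [hu, hv, if_false]
    exact fun h => hψ u (hV u hu) v (hV v hv) huv (hπ h)



/-- The bound extracted from `gammaLJ G V2 X1 Y1 ≤ l`. -/
lemma gamma_bound {V : Type u} [Fintype V] [DecidableEq V] (G : SimpleGraph V)
    (V2 X1 Y1 : Finset V) (l : ℕ) (hl : gammaLJ G V2 X1 Y1 ≤ l)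
    (v : V) (T : Finset V) (hvT : v ∈ T) (hT : G.IsClique (T : Set V))
    (hsub : T ⊆ V2 ∪ X1 ∪ Y1)
    (hno : ¬((∃ x ∈ T, x ∈ X1 ∧ x ∉ Y1) ∧ ∃ y ∈ T, y ∈ Y1 ∧ y ∉ X1))
    (D : Finset V) (hD : ∀ u ∈ D, G.Adj v u) :
    D.card + 1 + T.card ≤ 2 * l := by
  classical
  have h1 : (degree' G v + 1 + omegaJ G V2 X1 Y1 v + 1) / 2 ≤ l :=
    le_trans (Finset.le_sup (f := fun v => (degree' G v + 1 + omegaJ G V2 X1 Y1 v + 1) / 2)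
      (hsub hvT)) hl
  have h2 : T.card ≤ omegaJ G V2 X1 Y1 v := by
    unfold omegaJ
    apply le_csSup
    · refine ⟨Fintype.card V, ?_⟩
      rintro n ⟨s, hs, -⟩
      rw [← hs.card_eq]
      exact Finset.card_le_univ s
    · exact ⟨T, ⟨hT, rfl⟩, hvT, hsub, hno⟩
  have h3 : D.card ≤ degree' G v := by
    unfold degree'
    rw [← Set.ncard_coe_finset]
    apply Set.ncard_le_ncard _ (Set.toFinite _)
    intro u hu
    exact hD u (by simpa using hu)
  omega

lemma same_side_adj {V : Type u} (G : SimpleGraph V) {k : ℕ} {e00 : Bool}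
    {M : Set (Sym2 (AHV k))} {R : Set (AHV k)} {D : Set V} {f : V → AHV k}
    (ht : IsThickeningBetween (antihatH k e00 ⊔ SimpleGraph.fromEdgeSet M) M R G D f)
    {a b : V} (ha : a ∈ D) (hb : b ∈ D) (hab : a ≠ b)
    (hadj : f a ≠ f b → (antihatH k e00).Adj (f a) (f b) ∧ s(f a, f b) ∉ M) : G.Adj a b := by
  by_cases h : f a = f b
  · exact ht.fibers_clique (f b) ⟨ha, h⟩ ⟨hb, rfl⟩ hab
  · exact ht.adj_of_adj a ha b hb h (Or.inl (hadj h).1) (hadj h).2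

/-- No three pairwise nonadjacent vertices in an antihat strip together with `X1 ∩ Y1`. -/
lemma strip_no_triad {V : Type u} [Fintype V] [DecidableEq V] (G : SimpleGraph V)
    (V1 V2 X1 Y1 X2 Y2 : Finset V) (hj : IsGen2Join G V1 V2 X1 Y1 X2 Y2)
    (hstrip : IsAntihatStripOn G V2 X2 Y2) :
    ∀ a ∈ V2 ∪ (X1 ∩ Y1), ∀ b ∈ V2 ∪ (X1 ∩ Y1), ∀ c ∈ V2 ∪ (X1 ∩ Y1),
      a ≠ b → a ≠ c → b ≠ c → G.Adj a b ∨ G.Adj a c ∨ G.Adj b c := by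
  classical
  obtain ⟨k, e00, Xd, M, f, hk, ha0, hb0, -, hM, ht, hX2, hY2, -⟩ := hstrip
  obtain ⟨-, -, hMA, hMB, hMC, -, hMAB, hMBC, hMAC⟩ := hM
  -- classification of the vertices of the strip
  have key : ∀ v ∈ V2, (v ∈ X2 ∧ ∃ i : Fin (k+1), 1 ≤ i.val ∧ f v = ahA i) ∨
      (v ∈ Y2 ∧ ∃ i : Fin (k+1), 1 ≤ i.val ∧ f v = ahB i) ∨
      (∃ m : Fin k, f v = ahC m ∧ ahC m ∉ Xd) := by
    intro v hv
    have hr := ht.maps_into v hv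
    simp only [Set.mem_compl_iff, Set.mem_union, Set.mem_insert_iff, Set.mem_singleton_iff,
      Finset.mem_coe, not_or] at hr
    obtain ⟨h1, h2, h3⟩ := hr
    rcases hfv : f v with i | i | m
    · left
      have hi : 1 ≤ i.val := by
        by_contra hh
        apply h2
        rw [hfv]
        have : i = 0 := by
          apply Fin.ext
          rw [Fin.val_zero]; omega
        rw [this]; rfl
      rw [hfv] at h1
      refine ⟨?_, i, hi, rfl⟩
      rw [← Finset.mem_coe, hX2]
      exact ⟨hv, i, hi, hfv, h1⟩
    · right; left
      have hi : 1 ≤ i.val := by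
        by_contra hh
        apply h3
        rw [hfv]
        have : i = 0 := by
          apply Fin.ext
          rw [Fin.val_zero]; omega
        rw [this]; rfl
      rw [hfv] at h1
      refine ⟨?_, i, hi, rfl⟩
      rw [← Finset.mem_coe, hY2]
      exact ⟨hv, i, hi, hfv, h1⟩
    · right; right
      rw [hfv] at h1
      exact ⟨m, rfl, h1⟩
  have hAA : ∀ u v, u ∈ X2 → v ∈ X2 → u ≠ v → G.Adj u v := fun u v hu hv h =>
    hj.cliqueX (Or.inr hu) (Or.inr hv) h
  have hBB : ∀ u v, u ∈ Y2 → v ∈ Y2 → u ≠ v → G.Adj u v := fun u v hu hv h =>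
    hj.cliqueY (Or.inr hu) (Or.inr hv) h
  have hCC : ∀ u ∈ V2, ∀ v ∈ V2, u ≠ v → ∀ m n : Fin k, f u = ahC m → f v = ahC n →
      G.Adj u v := by
    intro u hu v hv h m n hm hn
    refine same_side_adj G ht hu hv h (fun hne => ?_)
    rw [hm, hn] at hne ⊢
    refine ⟨?_, hMC m n⟩
    simp only [antihatH, SimpleGraph.fromRel_adj]
    exact ⟨hne, Or.inl trivial⟩
  have hAC : ∀ u ∈ V2, ∀ v ∈ V2, u ≠ v → ∀ (i : Fin (k+1)) (m : Fin k), 1 ≤ i.val →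
      f u = ahA i → f v = ahC m → ¬ G.Adj u v → i.val = m.val + 1 := by
    intro u hu v hv h i m hi hm hn hna
    by_contra hc
    apply hna
    refine same_side_adj G ht hu hv h (fun hne => ?_)
    rw [hm, hn] at hne ⊢
    refine ⟨?_, fun hh => hc (hMAC i m hi hh).1⟩
    simp only [antihatH, SimpleGraph.fromRel_adj]
    exact ⟨hne, Or.inl ⟨hi, hc⟩⟩
  have hBC : ∀ u ∈ V2, ∀ v ∈ V2, u ≠ v → ∀ (i : Fin (k+1)) (m : Fin k), 1 ≤ i.val →
      f u = ahB i → f v = ahC m → ¬ G.Adj u v → i.val = m.val + 1 := by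
    intro u hu v hv h i m hi hm hn hna
    by_contra hc
    apply hna
    refine same_side_adj G ht hu hv h (fun hne => ?_)
    rw [hm, hn] at hne ⊢
    refine ⟨?_, fun hh => hc (hMBC i m hi hh).1⟩
    simp only [antihatH, SimpleGraph.fromRel_adj]
    exact ⟨hne, Or.inl ⟨hi, hc⟩⟩
  have hABC : ∀ u ∈ V2, ∀ v ∈ V2, ∀ w ∈ V2, u ≠ v → u ≠ w → v ≠ w →
      (∃ i : Fin (k+1), 1 ≤ i.val ∧ f u = ahA i) → (∃ i : Fin (k+1), 1 ≤ i.val ∧ f v = ahB i) →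
      (∃ m : Fin k, f w = ahC m ∧ ahC m ∉ Xd) →
      G.Adj u v ∨ G.Adj u w ∨ G.Adj v w := by
    rintro u hu v hv w hw huv huw hvw ⟨i, hi, hfi⟩ ⟨j, hjj, hfj⟩ ⟨m, hfm, hmX⟩
    by_contra hcon
    push Not at hcon
    obtain ⟨n1, n2, n3⟩ := hcon
    have e1 := hAC u hu w hw huw i m hi hfi hfm n2
    have e2 := hBC v hv w hw hvw j m hjj hfj hfm n3
    have hij : i = j := Fin.ext (by omega)
    subst hij
    apply n1
    refine same_side_adj G ht hu hv huv (fun hne => ?_)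
    rw [hfi, hfj] at hne ⊢
    constructor
    · simp only [antihatH, SimpleGraph.fromRel_adj]
      exact ⟨hne, Or.inl (Or.inl ⟨rfl, hi⟩)⟩
    · intro hh
      obtain ⟨-, c, hc, hcX⟩ := hMAB i i hi hi hh
      have : c = m := Fin.ext (by omega)
      exact hmX (this ▸ hcX)
  have hZX : ∀ z ∈ X1 ∩ Y1, ∀ v ∈ X2, z ≠ v → G.Adj z v := fun z hz v hv h =>
    hj.cliqueX (Or.inl (Finset.mem_inter.1 hz).1) (Or.inr hv) h
  have hZY : ∀ z ∈ X1 ∩ Y1, ∀ v ∈ Y2, z ≠ v → G.Adj z v := fun z hz v hv h =>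
    hj.cliqueY (Or.inl (Finset.mem_inter.1 hz).2) (Or.inr hv) h
  have hZZ : ∀ z ∈ X1 ∩ Y1, ∀ v ∈ X1 ∩ Y1, z ≠ v → G.Adj z v := fun z hz v hv h =>
    hj.cliqueX (Or.inl (Finset.mem_inter.1 hz).1) (Or.inl (Finset.mem_inter.1 hv).1) h
  -- one vertex in `X1 ∩ Y1`, the other two in the strip
  have hZVV : ∀ z ∈ X1 ∩ Y1, ∀ u ∈ V2, ∀ v ∈ V2, z ≠ u → z ≠ v → u ≠ v →
      G.Adj z u ∨ G.Adj z v ∨ G.Adj u v := by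
    intro z hz u hu v hv h1 h2 h3
    rcases key u hu with ⟨hu', -⟩ | ⟨hu', -⟩ | ⟨m, hm, -⟩
    · exact Or.inl (hZX z hz u hu' h1)
    · exact Or.inl (hZY z hz u hu' h1)
    rcases key v hv with ⟨hv', -⟩ | ⟨hv', -⟩ | ⟨n, hn, -⟩
    · exact Or.inr (Or.inl (hZX z hz v hv' h2))
    · exact Or.inr (Or.inl (hZY z hz v hv' h2))
    · exact Or.inr (Or.inr (hCC u hu v hv h3 m n hm hn))
  intro a ha b hb c hc hab hac hbc
  by_contra hcon
  push Not at hcon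
  obtain ⟨n1, n2, n3⟩ := hcon
  have n1' : ¬ G.Adj b a := fun h => n1 h.symm
  have n2' : ¬ G.Adj c a := fun h => n2 h.symm
  have n3' : ¬ G.Adj c b := fun h => n3 h.symm
  rcases Finset.mem_union.1 ha with ha | ha
  · rcases Finset.mem_union.1 hb with hb | hb
    · rcases Finset.mem_union.1 hc with hc | hc
      · have HA : ∀ u v, u ∈ X2 ∧ (∃ i : Fin (k+1), 1 ≤ i.val ∧ f u = ahA i) →
            v ∈ X2 ∧ (∃ i : Fin (k+1), 1 ≤ i.val ∧ f v = ahA i) → u ≠ v → G.Adj u v :=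
          fun u v h h' hh => hAA u v h.1 h'.1 hh
        have HB : ∀ u v, u ∈ Y2 ∧ (∃ i : Fin (k+1), 1 ≤ i.val ∧ f u = ahB i) →
            v ∈ Y2 ∧ (∃ i : Fin (k+1), 1 ≤ i.val ∧ f v = ahB i) → u ≠ v → G.Adj u v :=
          fun u v h h' hh => hBB u v h.1 h'.1 hh
        have HC : ∀ u ∈ V2, ∀ v ∈ V2, (∃ m : Fin k, f u = ahC m ∧ ahC m ∉ Xd) →
            (∃ m : Fin k, f v = ahC m ∧ ahC m ∉ Xd) → u ≠ v → G.Adj u v := by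
          rintro u hu v hv ⟨m, hm, -⟩ ⟨n, hn, -⟩ hh
          exact hCC u hu v hv hh m n hm hn
        rcases key a ha with ka | ka | ka <;> rcases key b hb with kb | kb | kb
        · exact n1 (HA a b ka kb hab)
        · rcases key c hc with kc | kc | kc
          · exact n2 (HA a c ka kc hac)
          · exact n3 (HB b c kb kc hbc)
          · have := hABC a ha b hb c hc hab hac hbc ka.2 kb.2 kc
            tauto
        · rcases key c hc with kc | kc | kc
          · exact n2 (HA a c ka kc hac)
          · have := hABC a ha c hc b hb hac hab hbc.symm ka.2 kc.2 kb
            tauto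
          · exact n3 (HC b hb c hc kb kc hbc)
        · rcases key c hc with kc | kc | kc
          · exact n3 (HA b c kb kc hbc)
          · exact n2 (HB a c ka kc hac)
          · have := hABC b hb a ha c hc hab.symm hbc hac kb.2 ka.2 kc
            tauto
        · exact n1 (HB a b ka kb hab)
        · rcases key c hc with kc | kc | kc
          · have := hABC c hc a ha b hb hac.symm hbc.symm hab kc.2 ka.2 kb
            tauto
          · exact n2 (HB a c ka kc hac)
          · exact n3 (HC b hb c hc kb kc hbc)
        · rcases key c hc with kc | kc | kc
          · exact n3 (HA b c kb kc hbc)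
          · have := hABC b hb c hc a ha hbc hab.symm hac.symm kb.2 kc.2 ka
            tauto
          · exact n2 (HC a ha c hc ka kc hac)
        · rcases key c hc with kc | kc | kc
          · have := hABC c hc b hb a ha hbc.symm hac.symm hab.symm kc.2 kb.2 ka
            tauto
          · exact n3 (HB b c kb kc hbc)
          · exact n2 (HC a ha c hc ka kc hac)
        · exact n1 (HC a ha b hb ka kb hab)
      · have := hZVV c hc a ha b hb hac.symm hbc.symm hab
        tauto
    · rcases Finset.mem_union.1 hc with hc | hc
      · have := hZVV b hb a ha c hc hab.symm hbc hac
        tauto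
      · exact n3 (hZZ b hb c hc hbc)
  · rcases Finset.mem_union.1 hb with hb | hb
    · rcases Finset.mem_union.1 hc with hc | hc
      · have := hZVV a ha b hb c hc hab hac hbc
        tauto
      · exact n2 (hZZ a ha c hc hac)
    · exact n1 (hZZ a ha b hb hab)

/-- A colouring of an induced subgraph, extended arbitrarily. -/
lemma properOn_of_induce {V : Type u} [DecidableEq V] (G : SimpleGraph V) (S : Finset V) (l : ℕ)
    (hl : 0 < l) (h : (G.induce (↑S : Set V)).Colorable l) :
    ∃ φ : V → Fin l, ProperOn G S φ := by
  classical
  obtain ⟨C⟩ := h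
  refine ⟨fun v => if hv : v ∈ S then C ⟨v, hv⟩ else ⟨0, hl⟩, ?_⟩
  intro u hu v hv huv
  simp only [hu, hv, dif_pos]
  exact C.valid (v := ⟨u, hu⟩) (w := ⟨v, hv⟩) huv


theorem stmt15 {V : Type*} [Fintype V] [DecidableEq V] (G : SimpleGraph V)
    (V1 V2 X1 Y1 X2 Y2 : Finset V)
    (hsk : Skeletal G) (hcf : ClawFree G)
    (hj : IsGen2Join G V1 V2 X1 Y1 X2 Y2)
    (hstrip : IsAntihatStripOn G V2 X2 Y2)
    (l : ℕ) (hl : gammaLJ G V2 X1 Y1 ≤ l)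
    (hcol : (G.induce (↑V1 : Set V)).Colorable l) :
    G.Colorable l := by
  classical
  obtain ⟨v0, hv0⟩ : ∃ v, v ∈ V2 := by
    obtain ⟨k, e00, Xd, M, f, -, -, -, -, -, -, -, -, w, c0, c1, c2, c3, c4, hw, -⟩ := hstrip
    exact ⟨w, hw⟩
  have hγ := gamma_bound G V2 X1 Y1 l hl
  have hdis : ∀ v, v ∈ V1 → v ∉ V2 := fun v h1 h2 => Finset.disjoint_left.1 hj.disjV h1 h2
  have hl0 : 0 < l := by
    have := hγ v0 {v0} (by simp) (by simp) (by
        intro x hx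
        rw [Finset.mem_singleton] at hx
        subst hx
        simp [hv0]) (by
        rintro ⟨⟨x, hx, hx1, -⟩, -⟩
        rw [Finset.mem_singleton] at hx
        subst hx
        exact hdis x (hj.subX1 hx1) hv0) ∅ (by simp)
    simp at this
    omega
  have hXb : ∀ v ∈ X1 ∪ X2, ∀ D : Finset V, (∀ u ∈ D, G.Adj v u ∧ u ∉ X1 ∪ X2) →
      D.card + 2 * X1.card + 2 * X2.card ≤ 2 * l := by
    intro v hv D hD
    have hcl : G.IsClique ((X1 ∪ X2 : Finset V) : Set V) := by
      rw [Finset.coe_union]; exact hj.cliqueX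
    have hd : Disjoint X1 X2 := Finset.disjoint_left.2
      (fun x h1 h2 => hdis x (hj.subX1 h1) (hj.subX2 h2))
    have hd2 : Disjoint D ((X1 ∪ X2).erase v) := Finset.disjoint_left.2
      (fun x h1 h2 => (hD x h1).2 (Finset.mem_of_mem_erase h2))
    have := hγ v (X1 ∪ X2) hv hcl (by
        intro x hx
        rcases Finset.mem_union.1 hx with h | h
        · simp [h]
        · simp [hj.subX2 h]) (by
        rintro ⟨-, y, hy, hy1, hy2⟩
        rcases Finset.mem_union.1 hy with h | h
        · exact hy2 h
        · exact hdis y (hj.subY1 hy1) (hj.subX2 h)) (D ∪ (X1 ∪ X2).erase v) (by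
        intro u hu
        rcases Finset.mem_union.1 hu with h | h
        · exact (hD u h).1
        · exact hcl hv (Finset.mem_of_mem_erase h) (Finset.ne_of_mem_erase h).symm)
    have hpos : 0 < (X1 ∪ X2).card := Finset.card_pos.2 ⟨v, hv⟩
    rw [Finset.card_union_of_disjoint hd2, Finset.card_erase_of_mem hv] at this
    rw [Finset.card_union_of_disjoint hd] at this hpos
    omega
  have hYb : ∀ v ∈ Y1 ∪ Y2, ∀ D : Finset V, (∀ u ∈ D, G.Adj v u ∧ u ∉ Y1 ∪ Y2) →
      D.card + 2 * Y1.card + 2 * Y2.card ≤ 2 * l := by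
    intro v hv D hD
    have hcl : G.IsClique ((Y1 ∪ Y2 : Finset V) : Set V) := by
      rw [Finset.coe_union]; exact hj.cliqueY
    have hd : Disjoint Y1 Y2 := Finset.disjoint_left.2
      (fun x h1 h2 => hdis x (hj.subY1 h1) (hj.subY2 h2))
    have hd2 : Disjoint D ((Y1 ∪ Y2).erase v) := Finset.disjoint_left.2
      (fun x h1 h2 => (hD x h1).2 (Finset.mem_of_mem_erase h2))
    have := hγ v (Y1 ∪ Y2) hv hcl (by
        intro x hx
        rcases Finset.mem_union.1 hx with h | h
        · simp [h]
        · simp [hj.subY2 h]) (by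
        rintro ⟨⟨y, hy, hy1, hy2⟩, -⟩
        rcases Finset.mem_union.1 hy with h | h
        · exact hy2 h
        · exact hdis y (hj.subX1 hy1) (hj.subY2 h)) (D ∪ (Y1 ∪ Y2).erase v) (by
        intro u hu
        rcases Finset.mem_union.1 hu with h | h
        · exact (hD u h).1
        · exact hcl hv (Finset.mem_of_mem_erase h) (Finset.ne_of_mem_erase h).symm)
    have hpos : 0 < (Y1 ∪ Y2).card := Finset.card_pos.2 ⟨v, hv⟩
    rw [Finset.card_union_of_disjoint hd2, Finset.card_erase_of_mem hv] at this
    rw [Finset.card_union_of_disjoint hd] at this hpos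
    omega
  have hcol2 : (G.induce (↑(V2 ∪ (X1 ∩ Y1)) : Set V)).Colorable l := by
    refine colorable_of_no_triad _ ?_ l ?_
    · rintro ⟨a, ha⟩ ⟨b, hb⟩ ⟨c, hc⟩ hab hac hbc
      exact strip_no_triad G V1 V2 X1 Y1 X2 Y2 hj hstrip a ha b hb c hc
        (fun h => hab (Subtype.ext h)) (fun h => hac (Subtype.ext h))
        (fun h => hbc (Subtype.ext h))
    · intro v T hvT hT
      have hmem : ∀ x ∈ T.map (Function.Embedding.subtype _), x ∈ V2 ∪ (X1 ∩ Y1) := by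
        intro x hx
        obtain ⟨y, -, rfl⟩ := Finset.mem_map.1 hx
        exact y.2
      have := hγ v.1 (T.map (Function.Embedding.subtype _))
        (Finset.mem_map.2 ⟨v, hvT, rfl⟩) (by
          intro x hx y hy hxy
          obtain ⟨x', hx', rfl⟩ := Finset.mem_map.1 hx
          obtain ⟨y', hy', rfl⟩ := Finset.mem_map.1 hy
          exact hT hx' hy' (fun h => hxy (by rw [h]))) (by
          intro x hx
          have := hmem x hx
          simp only [Finset.mem_union, Finset.mem_inter] at this ⊢
          tauto) (by
          rintro ⟨⟨x, hx, hx1, hx2⟩, -⟩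
          rcases Finset.mem_union.1 (hmem x hx) with h | h
          · exact hdis x (hj.subX1 hx1) h
          · exact hx2 (Finset.mem_inter.1 h).2)
        ((Finset.univ.filter
          ((G.induce (↑(V2 ∪ (X1 ∩ Y1)) : Set V)).Adj v)).map (Function.Embedding.subtype _)) (by
          intro u hu
          obtain ⟨u', hu', rfl⟩ := Finset.mem_map.1 hu
          exact (Finset.mem_filter.1 hu').2)
      rw [Finset.card_map, Finset.card_map] at this
      exact this
  exact combine G V1 V2 X1 Y1 X2 Y2 hj l hXb hYb (properOn_of_induce G V1 l hl0 hcol)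
    (properOn_of_induce G _ l hl0 hcol2)

end Paper
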